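/- arXiv:2105.08900 — 4 statements merged into one kernel-verified Lean document; each statement's English description precedes it below -/
import Mathlib

section
/- Let F be a Minkowski norm on a finite-dimensional real vector space E and let V ∈ E satisfy F(−V) > 1. Then the set A := { y + F(y)·V : y ∈ E ∖ {0}, g_y(y,V) < −F(y) } coincides with the set { t·(y′ + V) : t > 0, y′ ∈ E, F(y′) < 1 }. -/
/-- The fundamental tensor of a (Minkowski-type) norm `F` at `y`:
`g_y(u,v) = (1/2) D²(F²)(y)(u,v)`. -/
noncomputable def fundTensor {E : Type*} [NormedAddCommGroup E] [NormedSpace ℝ E]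
    (F : E → ℝ) (y u v : E) : ℝ :=
  (1 / 2) * iteratedFDeriv ℝ 2 (fun z => (F z) ^ 2) y ![u, v]

/-- A Minkowski norm on a finite dimensional real vector space `E`. -/
structure IsMinkowskiNorm {E : Type*} [NormedAddCommGroup E] [NormedSpace ℝ E]
    (F : E → ℝ) : Prop where
  map_zero : F 0 = 0
  pos : ∀ y : E, y ≠ 0 → 0 < F y
  smooth : ContDiffOn ℝ (⊤ : ℕ∞) F {(0 : E)}ᶜ
  homog : ∀ t : ℝ, 0 < t → ∀ y : E, F (t • y) = t * F y
  symm : ∀ y : E, y ≠ 0 → ∀ u v : E, fundTensor F y u v = fundTensor F y v u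
  posdef : ∀ y : E, y ≠ 0 → ∀ u : E, u ≠ 0 → 0 < fundTensor F y u u

namespace IsMinkowskiNorm

variable {E : Type*} [NormedAddCommGroup E] [NormedSpace ℝ E] {F : E → ℝ}

lemma nonneg (hF : IsMinkowskiNorm F) (y : E) : 0 ≤ F y := by
  by_cases hy : y = 0
  · rw [hy, hF.map_zero]
  · exact (hF.pos y hy).le

lemma contDiffAt (hF : IsMinkowskiNorm F) {y : E} (hy : y ≠ 0) :
    ContDiffAt ℝ (⊤ : ℕ∞) F y :=
  hF.smooth.contDiffAt (isOpen_compl_singleton.mem_nhds hy)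

lemma hasFDerivAt (hF : IsMinkowskiNorm F) {y : E} (hy : y ≠ 0) :
    HasFDerivAt F (fderiv ℝ F y) y :=
  ((hF.contDiffAt hy).differentiableAt (by simp)).hasFDerivAt

lemma hasFDerivAt_sq (hF : IsMinkowskiNorm F) {y : E} (hy : y ≠ 0) :
    HasFDerivAt (fun z => F z ^ 2) ((2 * F y) • fderiv ℝ F y) y := by
  simpa using (hF.hasFDerivAt hy).pow 2

lemma hasFDerivAt_fderiv_sq (hF : IsMinkowskiNorm F) {y : E} (hy : y ≠ 0) :
    HasFDerivAt (fderiv ℝ fun z => F z ^ 2) (fderiv ℝ (fderiv ℝ fun z => F z ^ 2) y) y := by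
  have h : ContDiffAt ℝ (⊤ : ℕ∞) (fun z => F z ^ 2) y := (hF.contDiffAt hy).pow 2
  have h' : ContDiffAt ℝ 1 (fderiv ℝ fun z => F z ^ 2) y :=
    h.fderiv_right (by norm_cast)
  exact (h'.differentiableAt (by simp)).hasFDerivAt

/-- Euler's identity for `F`. -/
lemma fderiv_self (hF : IsMinkowskiNorm F) {y : E} (hy : y ≠ 0) : fderiv ℝ F y y = F y := by
  have hline : HasDerivAt (fun t : ℝ => t • y) y 1 := by
    simpa using (hasDerivAt_id (1 : ℝ)).smul_const y
  have h₁ : HasDerivAt (fun t : ℝ => F (t • y)) (fderiv ℝ F y y) 1 :=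
    HasFDerivAt.comp_hasDerivAt (l := F) (1 : ℝ) (by simpa using hF.hasFDerivAt hy) hline
  have h₂ : HasDerivAt (fun t : ℝ => t * F y) (F y) 1 := by
    simpa using (hasDerivAt_id (1 : ℝ)).mul_const (F y)
  refine h₁.unique (h₂.congr_of_eventuallyEq ?_)
  filter_upwards [lt_mem_nhds (zero_lt_one' ℝ)] with t ht using hF.homog t ht y

lemma fderiv_sq_smul (hF : IsMinkowskiNorm F) {y : E} (hy : y ≠ 0) {t : ℝ} (ht : 0 < t) :
    fderiv ℝ (fun z => F z ^ 2) (t • y) = t • fderiv ℝ (fun z => F z ^ 2) y := by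
  have hty : t • y ≠ 0 := smul_ne_zero ht.ne' hy
  have hsmul : HasFDerivAt (fun z : E => t • z) (t • ContinuousLinearMap.id ℝ E) y :=
    (hasFDerivAt_id y).const_smul t
  have h₁ := (hF.hasFDerivAt_sq hty).differentiableAt.hasFDerivAt.comp y hsmul
  have h₂ := (hF.hasFDerivAt_sq hy).differentiableAt.hasFDerivAt.const_mul (t ^ 2)
  have h := h₁.unique (h₂.congr_of_eventuallyEq
    (Filter.Eventually.of_forall fun z => by simp [hF.homog t ht, mul_pow]))
  ext v
  have hv := congrArg (fun L : E →L[ℝ] ℝ => L v) h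
  simp only [ContinuousLinearMap.comp_apply, smul_apply, map_smul,
    ContinuousLinearMap.id_apply, smul_eq_mul] at hv ⊢
  exact mul_left_cancel₀ ht.ne' (by rw [hv]; ring)

lemma fundTensor_self_left (hF : IsMinkowskiNorm F) {y : E} (hy : y ≠ 0) (v : E) :
    fundTensor F y y v = F y * fderiv ℝ F y v := by
  have hline : HasDerivAt (fun t : ℝ => t • y) y 1 := by
    simpa using (hasDerivAt_id (1 : ℝ)).smul_const y
  have h₁ : HasDerivAt (fun t : ℝ => fderiv ℝ (fun z => F z ^ 2) (t • y))
      (fderiv ℝ (fderiv ℝ fun z => F z ^ 2) y y) 1 :=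
    HasFDerivAt.comp_hasDerivAt (l := fderiv ℝ fun z => F z ^ 2) (1 : ℝ)
      (by simpa using hF.hasFDerivAt_fderiv_sq hy) hline
  have h₂ : HasDerivAt (fun t : ℝ => t • fderiv ℝ (fun z => F z ^ 2) y)
      (fderiv ℝ (fun z => F z ^ 2) y) 1 := by
    simpa using (hasDerivAt_id (1 : ℝ)).smul_const (fderiv ℝ (fun z => F z ^ 2) y)
  have h := h₁.unique (h₂.congr_of_eventuallyEq (by
    filter_upwards [lt_mem_nhds (zero_lt_one' ℝ)] with t ht using hF.fderiv_sq_smul hy ht))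
  simp only [fundTensor, iteratedFDeriv_two_apply, Matrix.cons_val_zero, Matrix.cons_val_one, h,
    (hF.hasFDerivAt_sq hy).fderiv, smul_apply, smul_eq_mul]
  ring

/-- `F ^ 2` lies above its tangent at `y` along any segment avoiding the origin. -/
lemma sq_add_fderiv_sq_le (hF : IsMinkowskiNorm F) {x y : E}
    (h0 : ∀ r ∈ Set.Icc (0 : ℝ) 1, y + r • (x - y) ≠ 0) :
    F y ^ 2 + fderiv ℝ (fun z => F z ^ 2) y (x - y) ≤ F x ^ 2 := by
  have hline : ∀ r : ℝ, HasDerivAt (fun r : ℝ => y + r • (x - y)) (x - y) r := fun r => by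
    simpa using ((hasDerivAt_id r).smul_const (x - y)).const_add y
  have h₁ : ∀ r ∈ Set.Icc (0 : ℝ) 1, HasDerivAt (fun r : ℝ => F (y + r • (x - y)) ^ 2)
      (fderiv ℝ (fun z => F z ^ 2) (y + r • (x - y)) (x - y)) r := fun r hr =>
    HasFDerivAt.comp_hasDerivAt (l := fun z => F z ^ 2) r
      (hF.hasFDerivAt_sq (h0 r hr)).differentiableAt.hasFDerivAt (hline r)
  have h₂ : ∀ r ∈ Set.Icc (0 : ℝ) 1,
      HasDerivAt (fun r : ℝ => fderiv ℝ (fun z => F z ^ 2) (y + r • (x - y)) (x - y))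
        (fderiv ℝ (fderiv ℝ fun z => F z ^ 2) (y + r • (x - y)) (x - y) (x - y)) r := by
    intro r hr
    have h := HasFDerivAt.comp_hasDerivAt (l := fderiv ℝ fun z => F z ^ 2) r
      (hF.hasFDerivAt_fderiv_sq (h0 r hr)) (hline r)
    simpa using h.clm_apply (hasDerivAt_const r (x - y))
  have hpos : ∀ r ∈ Set.Icc (0 : ℝ) 1,
      0 ≤ fderiv ℝ (fderiv ℝ fun z => F z ^ 2) (y + r • (x - y)) (x - y) (x - y) := by
    intro r hr
    by_cases hxy : x - y = 0
    · simp [hxy]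
    · have h := hF.posdef _ (h0 r hr) _ hxy
      simp only [fundTensor, iteratedFDeriv_two_apply, Matrix.cons_val_zero,
        Matrix.cons_val_one] at h
      linarith
  obtain ⟨c, hc, hc'⟩ := exists_hasDerivAt_eq_slope _ _ (zero_lt_one' ℝ)
    (fun r hr => (h₁ r hr).continuousAt.continuousWithinAt)
    (fun r hr => h₁ r (Set.Ioo_subset_Icc_self hr))
  have hsub : Set.Icc 0 c ⊆ Set.Icc (0 : ℝ) 1 := Set.Icc_subset_Icc_right hc.2.le
  obtain ⟨d, hd, hd'⟩ := exists_hasDerivAt_eq_slope _ _ hc.1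
    (fun r hr => (h₂ r (hsub hr)).continuousAt.continuousWithinAt)
    (fun r hr => h₂ r (hsub (Set.Ioo_subset_Icc_self hr)))
  have hd0 := hpos d (hsub (Set.Ioo_subset_Icc_self hd))
  rw [hd', sub_zero, le_div_iff₀ hc.1] at hd0
  simp only [zero_smul, add_zero, one_smul, add_sub_cancel, sub_zero, div_one] at hc' hd0
  linarith

/-- The fundamental inequality of Finsler geometry. -/
lemma fderiv_le (hF : IsMinkowskiNorm F) {y : E} (hy : y ≠ 0) (x : E) :
    fderiv ℝ F y x ≤ F x := by
  by_cases hcol : ∃ k : ℝ, k ≤ 0 ∧ x = k • y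
  · obtain ⟨k, hk, rfl⟩ := hcol
    rw [map_smul, hF.fderiv_self hy, smul_eq_mul]
    exact (mul_nonpos_of_nonpos_of_nonneg hk (hF.nonneg y)).trans (hF.nonneg _)
  push Not at hcol
  have hx : x ≠ 0 := fun h => hcol 0 le_rfl (by simpa using h)
  have hFx := hF.pos x hx
  have hFy := hF.pos y hy
  have hq : 0 < F y / F x := div_pos hFy hFx
  have h := hF.sq_add_fderiv_sq_le (y := y) (x := (F y / F x) • x) (by
    intro r hr h
    rcases hr.1.eq_or_lt with rfl | hr0
    · exact hy (by simpa using h)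
    · refine hcol (-((1 - r) / (r * (F y / F x)))) ?_ ?_
      · exact neg_nonpos.2 (div_nonneg (sub_nonneg.2 hr.2) (by positivity))
      · have h' : (r * (F y / F x)) • x = -((1 - r) • y) := by
          rw [← sub_eq_zero, ← h]; module
        rw [← smul_neg, ← eq_inv_smul_iff₀ (mul_pos hr0 hq).ne'] at h'
        exact h'.trans (by rw [smul_smul, smul_neg, neg_smul, div_eq_inv_mul (1 - r)]))
  rw [hF.homog _ hq, (hF.hasFDerivAt_sq hy).fderiv, div_mul_cancel₀ _ hFx.ne'] at h
  simp only [map_sub, map_smul, smul_apply, smul_eq_mul,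
    hF.fderiv_self hy] at h
  have h' : F y / F x * fderiv ℝ F y x ≤ F y := by nlinarith
  rw [div_mul_eq_mul_div, div_le_iff₀ hFx] at h'
  exact le_of_mul_le_mul_left h' hFy

lemma continuous [FiniteDimensional ℝ E] (hF : IsMinkowskiNorm F) : Continuous F := by
  obtain ⟨M, hM⟩ := (isCompact_sphere (0 : E) 1).exists_bound_of_continuousOn
    (hF.smooth.continuousOn.mono fun z hz => by
      rintro rfl
      simp at hz)
  have hbound : ∀ z : E, ‖F z‖ ≤ M * ‖z‖ := by
    intro z
    by_cases hz : z = 0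
    · simp [hz, hF.map_zero]
    · have hz' : 0 < ‖z‖ := norm_pos_iff.2 hz
      have h := hM (‖z‖⁻¹ • z) (by simp [norm_smul, hz'.ne'])
      rw [hF.homog _ (inv_pos.2 hz'), norm_mul, norm_inv, norm_norm, inv_mul_le_iff₀ hz'] at h
      rwa [mul_comm]
  refine continuous_iff_continuousAt.2 fun y => ?_
  by_cases hy : y = 0
  · subst hy
    rw [ContinuousAt, hF.map_zero]
    refine squeeze_zero_norm hbound ?_
    have h : Continuous fun z : E => M * ‖z‖ := by fun_prop
    simpa using h.tendsto 0
  · exact (hF.contDiffAt hy).continuousAt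

end IsMinkowskiNorm

/-- for a Minkowski norm `F` and `V` with `F(-V) > 1`, the set
`A = {y + F(y)·V : y ≠ 0, g_y(y,V) < -F(y)}` coincides with
`{t·(y' + V) : t > 0, F(y') < 1}`. -/
theorem lorentz_navigation_cone_eq
    {E : Type*} [NormedAddCommGroup E] [NormedSpace ℝ E] [FiniteDimensional ℝ E]
    (F : E → ℝ) (hF : IsMinkowskiNorm F) (V : E) (hV : 1 < F (-V)) :
    {w : E | ∃ y : E, y ≠ 0 ∧ fundTensor F y y V < -(F y) ∧ w = y + F y • V}
      = {w : E | ∃ t : ℝ, 0 < t ∧ ∃ y' : E, F y' < 1 ∧ w = t • (y' + V)} := by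
  have hV0 : -V ≠ 0 := fun h => by
    rw [h, hF.map_zero] at hV
    linarith
  ext w
  constructor
  · rintro ⟨y, hy, hyV, rfl⟩
    have hFy := hF.pos y hy
    rw [hF.fundTensor_self_left hy] at hyV
    have hslope : fderiv ℝ F y V < -1 := by nlinarith
    have hderiv : HasDerivAt (fun r : ℝ => F (y + r • V) + r) (fderiv ℝ F y V + 1) 0 := by
      have hline : HasDerivAt (fun r : ℝ => y + r • V) V 0 := by
        simpa using ((hasDerivAt_id (0 : ℝ)).smul_const V).const_add y
      exact (HasFDerivAt.comp_hasDerivAt (l := F) (0 : ℝ)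
        (by simpa using hF.hasFDerivAt hy) hline).add (hasDerivAt_id 0)
    have hdecr : ∀ᶠ r in nhdsWithin (0 : ℝ) (Set.Ioi 0), F (y + r • V) + r < F y := by
      have h := (hasDerivAt_iff_tendsto_slope.1 hderiv).mono_left
        (nhdsWithin_mono 0 fun r (hr : 0 < r) => hr.ne')
      filter_upwards [h.eventually_lt_const (by linarith : fderiv ℝ F y V + 1 < 0),
        self_mem_nhdsWithin] with r hr hr0
      rw [slope_def_field, sub_zero, div_lt_iff₀ hr0] at hr
      simp only [zero_smul, add_zero, zero_mul] at hr
      linarith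
    obtain ⟨r, hr, hrF⟩ := (hdecr.and
      (mem_nhdsWithin_of_mem_nhds (Iio_mem_nhds hFy))).exists
    have ht : 0 < F y - r := sub_pos.2 hrF
    refine ⟨F y - r, ht, (F y - r)⁻¹ • (y + r • V), ?_, ?_⟩
    · rw [hF.homog _ (inv_pos.2 ht), inv_mul_lt_iff₀ ht]
      linarith
    · rw [smul_add, smul_inv_smul₀ ht.ne']
      module
  · rintro ⟨t, ht, x, hx, rfl⟩
    have hcont : Continuous fun r : ℝ => F (t • x - r • V) - (t + r) := by
      have := hF.continuous
      fun_prop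
    have hstart : F (t • x - (0 : ℝ) • V) - (t + 0) ≤ 0 := by
      rw [zero_smul, sub_zero, hF.homog t ht]
      nlinarith
    obtain ⟨R, hR0, hR⟩ : ∃ R : ℝ, 0 ≤ R ∧ 0 ≤ F (t • x - R • V) - (t + R) := by
      set a := fderiv ℝ F (-V) (t • x)
      have hV1 : 0 < F (-V) - 1 := sub_pos.2 hV
      refine ⟨|t - a| / (F (-V) - 1), by positivity, ?_⟩
      set R := |t - a| / (F (-V) - 1) with hRdef
      have hRmul : R * (F (-V) - 1) = |t - a| := div_mul_cancel₀ _ hV1.ne'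
      have h := hF.fderiv_le hV0 (t • x - R • V)
      rw [sub_eq_add_neg, ← smul_neg, map_add, map_smul _ R, hF.fderiv_self hV0,
        smul_eq_mul, smul_neg, ← sub_eq_add_neg] at h
      have := le_abs_self (t - a)
      linarith
    obtain ⟨r, hr, hr'⟩ := intermediate_value_Icc hR0 hcont.continuousOn ⟨hstart, hR⟩
    have hFy : F (t • x - r • V) = t + r := sub_eq_zero.1 hr'
    have hy : t • x - r • V ≠ 0 := fun h => by
      rw [h, hF.map_zero] at hFy
      linarith [hr.1]
    refine ⟨t • x - r • V, hy, ?_, ?_⟩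
    · rw [hF.fundTensor_self_left hy]
      have h := hF.fderiv_le hy (t • x)
      rw [hF.homog t ht, ← sub_add_cancel (t • x) (r • V), map_add, sub_add_cancel,
        hF.fderiv_self hy, map_smul, smul_eq_mul, hFy] at h
      have htx : t * F x < t := by nlinarith
      have hslope : fderiv ℝ F (t • x - r • V) V < -1 := by
        by_contra! hcon
        nlinarith [mul_le_mul_of_nonneg_left hcon hr.1]
      have hpos := hF.pos _ hy
      nlinarith
    · rw [hFy]
      module
end

section
/- Let F be a Minkowski norm on a finite-dimensional real vector space E, let V ∈ E, and let y ∈ E satisfy F(y) = 1 and 1 + g^F_y(y,V) ≠ 0; set ỹ := y + V. Suppose F̃ is a real-valued function, positive, C^∞ and positively 1-homogeneous on a conic open subset of E ∖ {0} containing ỹ, such that F̃(z + F(z)·V) = F(z) for all z ≠ 0 in some neighborhood of y. Then F̃(ỹ) = 1, and for all u, v ∈ E with g^F_y(y,u) = g^F_y(y,v) = 0 one has g^{F̃}_{ỹ}(ỹ,u) = 0 and g^{F̃}_{ỹ}(u,v) = g^F_y(u,v)/(1 + g^F_y(y,V)), where for any such function G the fundamental tensor is g^G_w(u,v) := (1/2)·D²(G²)(w)(u,v).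 -/
/-- The fundamental tensor in terms of the first two derivatives of the function itself. -/
theorem fundTensor_eq_fderiv {E : Type*} [NormedAddCommGroup E] [NormedSpace ℝ E]
    {G : E → ℝ} {x : E} (hG : ContDiffAt ℝ 2 G x) (u v : E) :
    fundTensor G x u v =
      fderiv ℝ G x u * fderiv ℝ G x v + G x * fderiv ℝ (fderiv ℝ G) x u v := by
  have hd : ∀ᶠ z in nhds x, DifferentiableAt ℝ G z :=
    (hG.eventually (by simp)).mono fun z hz => hz.differentiableAt (by simp)
  have hsq : fderiv ℝ (fun z => G z ^ 2) =ᶠ[nhds x] fun z => (2 * G z) • fderiv ℝ G z := by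
    filter_upwards [hd] with z hz
    have := (hz.hasFDerivAt.pow 2).fderiv
    simpa using this
  have hD : DifferentiableAt ℝ (fderiv ℝ G) x :=
    (hG.fderiv_right (m := 1) (by norm_num)).differentiableAt (by simp)
  have h2 := ((hd.self_of_nhds.hasFDerivAt.const_mul 2).smul hD.hasFDerivAt).fderiv
  rw [fundTensor, iteratedFDeriv_two_apply, hsq.fderiv_eq]
  erw [h2]
  simp
  ring

/-- The derivative of a positively 1-homogeneous function is positively 0-homogeneous, hence its
own derivative vanishes in the radial direction. -/
theorem fderiv_fderiv_apply_self_of_homogeneous {E : Type*} [NormedAddCommGroup E]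
    [NormedSpace ℝ E] {G : E → ℝ} {x : E} (hG : ContDiffAt ℝ 2 G x)
    (hom : ∀ t : ℝ, 0 < t → ∀ᶠ w in nhds x, G (t • w) = t * G w) :
    fderiv ℝ (fderiv ℝ G) x x = 0 := by
  have hD : DifferentiableAt ℝ (fderiv ℝ G) x :=
    (hG.fderiv_right (m := 1) (by norm_num)).differentiableAt (by simp)
  have hd : DifferentiableAt ℝ G x := hG.differentiableAt (by simp)
  have hconst : ∀ t : ℝ, 0 < t → fderiv ℝ G (t • x) = fderiv ℝ G x := by
    intro t ht
    have h1 : fderiv ℝ (fun w => G (t • w)) x = t • fderiv ℝ G x := by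
      rw [Filter.EventuallyEq.fderiv_eq (hom t ht)]
      exact fderiv_const_mul hd t
    rw [fderiv_comp_smul] at h1
    exact smul_right_injective _ ht.ne' h1
  have hray : HasDerivAt (fun t : ℝ => t • x) x 1 := by
    simpa using (hasDerivAt_id (1 : ℝ)).smul_const x
  have hcomp : HasDerivAt (fun t : ℝ => fderiv ℝ G (t • x)) (fderiv ℝ (fderiv ℝ G) x x) 1 :=
    HasFDerivAt.comp_hasDerivAt (1 : ℝ) (by simpa using hD.hasFDerivAt) hray
  have hc : (fun t : ℝ => fderiv ℝ G (t • x)) =ᶠ[nhds 1] fun _ => fderiv ℝ G x := by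
    filter_upwards [lt_mem_nhds (zero_lt_one : (0 : ℝ) < 1)] with t ht using hconst t ht
  exact hcomp.unique ((hasDerivAt_const (1 : ℝ) (fderiv ℝ G x)).congr_of_eventuallyEq hc)

/-- Euler's relation for positively 1-homogeneous functions. -/
theorem fderiv_apply_self_of_homogeneous {E : Type*} [NormedAddCommGroup E]
    [NormedSpace ℝ E] {G : E → ℝ} {x : E} (hG : DifferentiableAt ℝ G x)
    (hom : ∀ t : ℝ, 0 < t → ∀ᶠ w in nhds x, G (t • w) = t * G w) :
    fderiv ℝ G x x = G x := by
  have hray : HasDerivAt (fun t : ℝ => t • x) x 1 := by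
    simpa using (hasDerivAt_id (1 : ℝ)).smul_const x
  have hcomp : HasDerivAt (fun t : ℝ => G (t • x)) (fderiv ℝ G x x) 1 :=
    HasFDerivAt.comp_hasDerivAt (1 : ℝ) (by simpa using hG.hasFDerivAt) hray
  have hc : (fun t : ℝ => G (t • x)) =ᶠ[nhds 1] fun t => t * G x := by
    filter_upwards [lt_mem_nhds (zero_lt_one : (0 : ℝ) < 1)] with t ht
      using (hom t ht).self_of_nhds
  have hlin : HasDerivAt (fun t : ℝ => t * G x) (G x) 1 := by
    simpa using (hasDerivAt_id (1 : ℝ)).mul_const (G x)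
  exact hcomp.unique (hlin.congr_of_eventuallyEq hc)

theorem fundTensor_self_left {E : Type*} [NormedAddCommGroup E] [NormedSpace ℝ E]
    {G : E → ℝ} {x : E} (hG : ContDiffAt ℝ 2 G x)
    (hom : ∀ t : ℝ, 0 < t → ∀ᶠ w in nhds x, G (t • w) = t * G w) (v : E) :
    fundTensor G x x v = G x * fderiv ℝ G x v := by
  rw [fundTensor_eq_fderiv hG, fderiv_fderiv_apply_self_of_homogeneous hG hom,
    fderiv_apply_self_of_homogeneous (hG.differentiableAt (by simp)) hom]
  simp

/-- The first derivative of the navigation relation. -/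
theorem fderiv_navigation {E : Type*} [NormedAddCommGroup E] [NormedSpace ℝ E]
    {F Ft : E → ℝ} {V z : E} (hF : DifferentiableAt ℝ F z)
    (hFt : DifferentiableAt ℝ Ft (z + F z • V))
    (hnav : ∀ᶠ w in nhds z, Ft (w + F w • V) = F w) (u : E) :
    fderiv ℝ Ft (z + F z • V) (u + fderiv ℝ F z u • V) = fderiv ℝ F z u := by
  have hφ : HasFDerivAt (fun w => w + F w • V)
      (ContinuousLinearMap.id ℝ E + (fderiv ℝ F z).smulRight V) z :=
    (hasFDerivAt_id z).add (hF.hasFDerivAt.smul_const V)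
  have h := (hFt.hasFDerivAt.comp z hφ).unique (hF.hasFDerivAt.congr_of_eventuallyEq hnav)
  simpa using DFunLike.congr_fun h u

/-- The second derivative of the navigation relation, in directions tangent to the level set
of `F`. -/
theorem fderiv_fderiv_navigation {E : Type*} [NormedAddCommGroup E] [NormedSpace ℝ E]
    {F Ft : E → ℝ} {V y : E} (hF : ContDiffAt ℝ 2 F y)
    (hFt : ContDiffAt ℝ 2 Ft (y + F y • V))
    (hnav : ∀ᶠ w in nhds y, Ft (w + F w • V) = F w) {u v : E}
    (hu : fderiv ℝ F y u = 0) (hv : fderiv ℝ F y v = 0) :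
    fderiv ℝ (fderiv ℝ Ft) (y + F y • V) u v
      + fderiv ℝ (fderiv ℝ F) y u v * fderiv ℝ Ft (y + F y • V) V
      = fderiv ℝ (fderiv ℝ F) y u v := by
  have hdF : DifferentiableAt ℝ F y := hF.differentiableAt (by simp)
  have hφ : HasFDerivAt (fun w => w + F w • V)
      (ContinuousLinearMap.id ℝ E + (fderiv ℝ F y).smulRight V) y :=
    (hasFDerivAt_id y).add (hdF.hasFDerivAt.smul_const V)
  have hfirst : (fun z => fderiv ℝ Ft (z + F z • V) (v + fderiv ℝ F z v • V))
      =ᶠ[nhds y] fun z => fderiv ℝ F z v := by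
    filter_upwards [hF.eventually (by simp),
      hφ.continuousAt.eventually (hFt.eventually (by simp)),
      hnav.eventually_nhds] with z h1 h2 h3
    exact fderiv_navigation (h1.differentiableAt (by simp)) (h2.differentiableAt (by simp)) h3 v
  have hD : DifferentiableAt ℝ (fderiv ℝ F) y :=
    (hF.fderiv_right (m := 1) (by norm_num)).differentiableAt (by simp)
  have hDt : DifferentiableAt ℝ (fderiv ℝ Ft) (y + F y • V) :=
    (hFt.fderiv_right (m := 1) (by norm_num)).differentiableAt (by simp)
  have hDv : HasFDerivAt (fun z => fderiv ℝ F z v) ((fderiv ℝ (fderiv ℝ F) y).flip v) y := by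
    simpa using hD.hasFDerivAt.clm_apply (hasFDerivAt_const v y)
  have hDtφ : HasFDerivAt (fun z => fderiv ℝ Ft (z + F z • V)) _ y :=
    HasFDerivAt.comp y hDt.hasFDerivAt hφ
  have hl := hDtφ.clm_apply ((hDv.smul_const V).const_add v)
  have h := DFunLike.congr_fun (hl.unique (hDv.congr_of_eventuallyEq hfirst)) u
  simp [hu, hv] at h
  linarith

/-- fundamental tensor relation for the Zermelo navigation datum `(F, V)`,
at a unit vector `y` with `1 + g_y(y,V) ≠ 0` and `ỹ = y + V`. -/
theorem navigation_fundamental_tensor_relation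
    {E : Type*} [NormedAddCommGroup E] [NormedSpace ℝ E] [FiniteDimensional ℝ E]
    (F : E → ℝ) (hF : IsMinkowskiNorm F) (V y : E)
    (hy1 : F y = 1) (hnd : 1 + fundTensor F y y V ≠ 0)
    (Ft : E → ℝ) (C : Set E) (hCopen : IsOpen C) (hC0 : (0 : E) ∉ C)
    (hCcone : ∀ t : ℝ, 0 < t → ∀ w ∈ C, t • w ∈ C)
    (hmem : y + V ∈ C)
    (hFtpos : ∀ w ∈ C, 0 < Ft w)
    (hFtsmooth : ContDiffOn ℝ (⊤ : ℕ∞) Ft C)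
    (hFthomog : ∀ t : ℝ, 0 < t → ∀ w ∈ C, Ft (t • w) = t * Ft w)
    (hnav : ∀ᶠ z in nhds y, z ≠ 0 → Ft (z + F z • V) = F z) :
    Ft (y + V) = 1 ∧
    ∀ u v : E, fundTensor F y y u = 0 → fundTensor F y y v = 0 →
      fundTensor Ft (y + V) (y + V) u = 0 ∧
      fundTensor Ft (y + V) u v = fundTensor F y u v / (1 + fundTensor F y y V) := by
  have hy0 : y ≠ 0 := by
    rintro rfl
    simp [hF.map_zero] at hy1
  have hne : ∀ᶠ z in nhds y, z ≠ 0 := isOpen_ne.mem_nhds hy0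
  have hnav' : ∀ᶠ z in nhds y, Ft (z + F z • V) = F z := by
    filter_upwards [hnav, hne] with z h1 h2 using h1 h2
  have hyV : y + F y • V = y + V := by rw [hy1, one_smul]
  have hFty : Ft (y + V) = 1 := by
    rw [← hyV, hnav'.self_of_nhds, hy1]
  have hle : (2 : WithTop ℕ∞) ≤ ((⊤ : ℕ∞) : WithTop ℕ∞) := by
    exact WithTop.coe_le_coe.2 (le_top : (2 : ℕ∞) ≤ ⊤)
  have hF2 : ContDiffAt ℝ 2 F y := (hF.smooth.contDiffAt hne).of_le hle
  have hFt2 : ContDiffAt ℝ 2 Ft (y + V) :=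
    (hFtsmooth.contDiffAt (hCopen.mem_nhds hmem)).of_le hle
  have homF : ∀ t : ℝ, 0 < t → ∀ᶠ w in nhds y, F (t • w) = t * F w := fun t ht =>
    Filter.Eventually.of_forall (hF.homog t ht)
  have homFt : ∀ t : ℝ, 0 < t → ∀ᶠ w in nhds (y + V), Ft (t • w) = t * Ft w := fun t ht =>
    Filter.mem_of_superset (hCopen.mem_nhds hmem) (hFthomog t ht)
  have hgF : ∀ w, fundTensor F y y w = fderiv ℝ F y w := fun w => by
    rw [fundTensor_self_left hF2 homF, hy1, one_mul]
  have hfirst := fderiv_navigation (V := V) (hF2.differentiableAt (by simp))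
    (by rw [hyV]; exact hFt2.differentiableAt (by simp)) hnav'
  rw [hyV] at hfirst
  refine ⟨hFty, fun u v hu hv => ?_⟩
  rw [hgF] at hu hv hnd
  have hsecond := fderiv_fderiv_navigation hF2 (by rwa [hyV]) hnav' hu hv
  rw [hyV] at hsecond
  have htu : fderiv ℝ Ft (y + V) u = 0 := by simpa [hu] using hfirst u
  have hV := hfirst V
  rw [map_add, map_smul, smul_eq_mul] at hV
  refine ⟨by rw [fundTensor_self_left hFt2 homFt, htu, mul_zero], ?_⟩
  rw [hgF, eq_div_iff hnd, fundTensor_eq_fderiv hFt2, fundTensor_eq_fderiv hF2, htu, hu, hFty, hy1]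
  linear_combination (1 + fderiv ℝ F y V) * hsecond - fderiv ℝ (fderiv ℝ F) y u v * hV
end

section
/- Let x, y ∈ ℝⁿ (with the standard Euclidean inner product ⟨·,·⟩ and norm |·|) satisfy |x| > 1, y ≠ 0, and ⟨x,y⟩ > |y|, and set ỹ := y − |y|·x. Then ⟨x,ỹ⟩² − (|x|² − 1)·|ỹ|² = (⟨x,y⟩ − |y|)² > 0, and the Lorentz Funk (Lorentz Randers) metric value at ỹ recovers the Euclidean length of y: ( √(⟨x,ỹ⟩² − (|x|² − 1)|ỹ|²) − ⟨x,ỹ⟩ ) / (|x|² − 1) = |y|. -/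
open scoped RealInnerProductSpace

/-- the Lorentz Funk (Lorentz Randers) metric on `{|x| > 1} ⊆ ℝⁿ`,
induced by Zermelo navigation from the Euclidean metric with `V(x) = -x`, recovers the
Euclidean length: for `ỹ = y - |y|·x` with `⟨x,y⟩ > |y|` one has
`⟨x,ỹ⟩² - (|x|²-1)|ỹ|² = (⟨x,y⟩ - |y|)² > 0` and
`(√(⟨x,ỹ⟩² - (|x|²-1)|ỹ|²) - ⟨x,ỹ⟩)/(|x|²-1) = |y|`. -/
theorem lorentz_funk_navigation_identity
    (n : ℕ) (x y : EuclideanSpace ℝ (Fin n))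
    (hx : 1 < ‖x‖) (hy : y ≠ 0) (hxy : ‖y‖ < ⟪x, y⟫)
    (yt : EuclideanSpace ℝ (Fin n)) (hyt : yt = y - ‖y‖ • x) :
    ⟪x, yt⟫ ^ 2 - (‖x‖ ^ 2 - 1) * ‖yt‖ ^ 2 = (⟪x, y⟫ - ‖y‖) ^ 2 ∧
    0 < (⟪x, y⟫ - ‖y‖) ^ 2 ∧
    (Real.sqrt (⟪x, yt⟫ ^ 2 - (‖x‖ ^ 2 - 1) * ‖yt‖ ^ 2) - ⟪x, yt⟫) / (‖x‖ ^ 2 - 1)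
      = ‖y‖ := by
  have inner_yt : ⟪x, yt⟫ = ⟪x, y⟫ - ‖y‖ * ‖x‖ ^ 2 := by
    rw [hyt, inner_sub_right, real_inner_smul_right, real_inner_self_eq_norm_sq]
  have norm_sq_yt : ‖yt‖ ^ 2 = ‖y‖ ^ 2 - 2 * (‖y‖ * ⟪x, y⟫) + ‖y‖ ^ 2 * ‖x‖ ^ 2 := by
    rw [hyt, norm_sub_sq_real, real_inner_smul_right, real_inner_comm, norm_smul, norm_norm,
      mul_pow]
  have discriminant :
      ⟪x, yt⟫ ^ 2 - (‖x‖ ^ 2 - 1) * ‖yt‖ ^ 2 = (⟪x, y⟫ - ‖y‖) ^ 2 := by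
    rw [inner_yt, norm_sq_yt]
    ring
  have gap_pos : 0 < ⟪x, y⟫ - ‖y‖ := sub_pos.mpr hxy
  have denom_ne : ‖x‖ ^ 2 - 1 ≠ 0 := by nlinarith
  refine ⟨discriminant, pow_pos gap_pos 2, ?_⟩
  rw [discriminant, Real.sqrt_sq gap_pos.le, inner_yt, div_eq_iff denom_ne]
  ring
end

section
/- Let M ⊆ ℝⁿ be open, let F : M × (ℝⁿ ∖ {0}) → ℝ be smooth, positive, and positively 1-homogeneous in the second variable, with fundamental tensor g_{(x,y)} = (g_{ij}(x,y)) := ((1/2)∂²(F²)/∂y^i∂y^j (x,y)) positive definite for all (x,y). Suppose V : M → ℝⁿ is a smooth vector field that is homothetic with dilation c, i.e., Σ_i V^i(x)·∂F/∂x^i(x,y) + Σ_{i,j} y^j·(∂V^i/∂x^j)(x)·∂F/∂y^i(x,y) = −2c·F(x,y) for all x ∈ M and y ≠ 0. Let γ : I → M be a unit-speed geodesic of F, i.e., a smooth curve on an interval I containing 0 with F(γ(t), γ̇(t)) = 1 and γ̈^i(t) + 2G^i(γ(t), γ̇(t)) = 0 for all t ∈ I, where G^i(x,y) = (1/4)·g^{il}(x,y)·(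 Σ_k ∂²(F²)/∂x^k∂y^l (x,y)·y^k − ∂(F²)/∂x^l (x,y) ) and (g^{il}) is the inverse matrix of (g_{il}). Then for all t ∈ I, g_{(γ(t),γ̇(t))}( V(γ(t)), γ̇(t) ) = c₀ − 2ct, where c₀ = g_{(γ(0),γ̇(0))}( V(γ(0)), γ̇(0) ). -/
noncomputable section

/-- Fundamental tensor of a Finsler metric `F` on an open subset of `ℝⁿ`, at the point
`(x, y)`, evaluated on the pair of vectors `(u, v)`:
`g_{(x,y)}(u,v) = (1/2) ∂²(F²)/∂y²(x,y)(u,v)`. -/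
def finslerG (n : ℕ) (F : (Fin n → ℝ) → (Fin n → ℝ) → ℝ)
    (x y u v : Fin n → ℝ) : ℝ :=
  (1 / 2) * iteratedFDeriv ℝ 2 (fun z => (F x z) ^ 2) y ![u, v]

/-- Fundamental tensor matrix `g_{ij}(x,y) = (1/2)∂²(F²)/∂y^i∂y^j(x,y)`. -/
def finslerGMat (n : ℕ) (F : (Fin n → ℝ) → (Fin n → ℝ) → ℝ)
    (x y : Fin n → ℝ) : Matrix (Fin n) (Fin n) ℝ :=
  fun i j => finslerG n F x y (Pi.single i 1) (Pi.single j 1)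

/-- Geodesic spray coefficients
`G^i(x,y) = (1/4) g^{il}(x,y) ( Σ_k [F²]_{x^k y^l}(x,y) y^k − [F²]_{x^l}(x,y) )`,
where `(g^{il})` is the inverse matrix of `(g_{il})`. -/
def finslerSpray (n : ℕ) (F : (Fin n → ℝ) → (Fin n → ℝ) → ℝ)
    (x y : Fin n → ℝ) (i : Fin n) : ℝ :=
  (1 / 4) * ∑ l, (finslerGMat n F x y)⁻¹ i l *
    ((∑ k, fderiv ℝ (fun x' => fderiv ℝ (fun z => (F x' z) ^ 2) y (Pi.single l 1)) x
        (Pi.single k 1) * y k)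
      - fderiv ℝ (fun x' => (F x' y) ^ 2) x (Pi.single l 1))

end

namespace FinslerHomothetic

/-- The squared norm of a Finsler metric as a function on the product. -/
def energy {n : ℕ} (F : (Fin n → ℝ) → (Fin n → ℝ) → ℝ) (p : (Fin n → ℝ) × (Fin n → ℝ)) : ℝ :=
  F p.1 p.2 ^ 2

section Partial

variable {X Y Z : Type*} [NormedAddCommGroup X] [NormedSpace ℝ X]
  [NormedAddCommGroup Y] [NormedSpace ℝ Y] [NormedAddCommGroup Z] [NormedSpace ℝ Z]

theorem hasFDerivAt_partial_right {P : X × Y → Z} {x : X} {y : Y}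
    (h : DifferentiableAt ℝ P (x, y)) :
    HasFDerivAt (fun z => P (x, z))
      ((fderiv ℝ P (x, y)).comp (ContinuousLinearMap.inr ℝ X Y)) y :=
  h.hasFDerivAt.comp y (hasFDerivAt_prodMk_right x y)

theorem hasFDerivAt_partial_left {P : X × Y → Z} {x : X} {y : Y}
    (h : DifferentiableAt ℝ P (x, y)) :
    HasFDerivAt (fun z => P (z, y))
      ((fderiv ℝ P (x, y)).comp (ContinuousLinearMap.inl ℝ X Y)) x :=
  HasFDerivAt.comp (f := fun z => (z, y)) x h.hasFDerivAt (hasFDerivAt_prodMk_left x y)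

theorem eventually_differentiableAt {P : X → Z} {p : X} (h : ContDiffAt ℝ 2 P p) :
    ∀ᶠ q in nhds p, DifferentiableAt ℝ P q :=
  (h.eventually (by simp)).mono fun _ hq => hq.differentiableAt (by simp)

theorem differentiableAt_fderiv {P : X → Z} {p : X} (h : ContDiffAt ℝ 2 P p) :
    DifferentiableAt ℝ (fderiv ℝ P) p :=
  (h.fderiv_right (m := 1) (by norm_num)).differentiableAt (by simp)

theorem fderiv_fderiv_partial_right {P : X × Y → Z} {x : X} {y : Y}
    (h : ContDiffAt ℝ 2 P (x, y)) (u v : Y) :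
    fderiv ℝ (fderiv ℝ (fun z => P (x, z))) y u v
      = fderiv ℝ (fderiv ℝ P) (x, y) (0, u) (0, v) := by
  have hcont : Filter.Tendsto (fun z : Y => (x, z)) (nhds y) (nhds (x, y)) :=
    (Continuous.prodMk_right x).tendsto y
  have hev : fderiv ℝ (fun z => P (x, z)) =ᶠ[nhds y]
      fun z => (fderiv ℝ P (x, z)).comp (ContinuousLinearMap.inr ℝ X Y) := by
    filter_upwards [hcont.eventually (eventually_differentiableAt h)] with z hz
    exact (hasFDerivAt_partial_right hz).fderiv
  rw [hev.fderiv_eq,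
    ((hasFDerivAt_partial_right (differentiableAt_fderiv h)).clm_comp
      (hasFDerivAt_const (ContinuousLinearMap.inr ℝ X Y) y)).fderiv]
  simp

theorem fderiv_partial_left_fderiv_partial_right {P : X × Y → Z} {x : X} {y : Y}
    (h : ContDiffAt ℝ 2 P (x, y)) (u : X) (v : Y) :
    fderiv ℝ (fun x' => fderiv ℝ (fun z => P (x', z)) y v) x u
      = fderiv ℝ (fderiv ℝ P) (x, y) (u, 0) (0, v) := by
  have hcont : Filter.Tendsto (fun z : X => (z, y)) (nhds x) (nhds (x, y)) :=
    (Continuous.prodMk_left y).tendsto x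
  have hev : (fun x' => fderiv ℝ (fun z => P (x', z)) y v) =ᶠ[nhds x]
      fun x' => fderiv ℝ P (x', y) (0, v) := by
    filter_upwards [hcont.eventually (eventually_differentiableAt h)] with z hz
    rw [(hasFDerivAt_partial_right hz).fderiv]
    simp
  rw [hev.fderiv_eq,
    ((hasFDerivAt_partial_left (differentiableAt_fderiv h)).clm_apply
      (hasFDerivAt_const ((0 : X), v) x)).fderiv]
  simp

/-- Euler's identity for a positively 2-homogeneous function. -/
theorem fderiv_apply_self_of_homogeneous {f : Y → ℝ} {y : Y} (hf : DifferentiableAt ℝ f y)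
    (hhom : ∀ t : ℝ, 0 < t → f (t • y) = t ^ 2 * f y) : fderiv ℝ f y y = 2 * f y := by
  have h1 : HasDerivAt (fun t : ℝ => t • y) y 1 := by
    simpa using (hasDerivAt_id (1 : ℝ)).smul_const y
  have h2 : HasDerivAt (fun t : ℝ => f (t • y)) (fderiv ℝ f y y) 1 := by
    have hf' : HasFDerivAt f (fderiv ℝ f y) ((1 : ℝ) • y) := by simpa using hf.hasFDerivAt
    exact hf'.comp_hasDerivAt 1 h1
  have h3 : HasDerivAt (fun t : ℝ => t ^ 2 * f y) (2 * f y) 1 := by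
    simpa using (hasDerivAt_pow 2 (1 : ℝ)).mul_const (f y)
  refine h2.unique (h3.congr_of_eventuallyEq ?_)
  filter_upwards [lt_mem_nhds (zero_lt_one' ℝ)] with t ht using hhom t ht

/-- Differentiating Euler's identity. -/
theorem fderiv_fderiv_apply_self {f : Y → ℝ} {y : Y} (hf : ContDiffAt ℝ 2 f y)
    (heuler : ∀ᶠ z in nhds y, fderiv ℝ f z z = 2 * f z) (v : Y) :
    fderiv ℝ (fderiv ℝ f) y v y = fderiv ℝ f y v := by
  have h1 := (differentiableAt_fderiv hf).hasFDerivAt.clm_apply (hasFDerivAt_id y)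
  have h2 := (hf.differentiableAt (by simp)).hasFDerivAt.const_mul 2
  have h3 := congrArg (fun L => L v) (h1.unique (h2.congr_of_eventuallyEq heuler))
  simp at h3
  linarith

end Partial

theorem apply_eq_sum_single {n : ℕ} (L : (Fin n → ℝ) →L[ℝ] ℝ) (a : Fin n → ℝ) :
    L a = ∑ i, a i * L (Pi.single i 1) := by
  conv_lhs => rw [pi_eq_sum_univ' a]
  simp [map_sum, Pi.single]

section Finsler

variable {n : ℕ} {F : (Fin n → ℝ) → (Fin n → ℝ) → ℝ} {x y : Fin n → ℝ}

theorem finslerG_eq (h : ContDiffAt ℝ 2 (energy F) (x, y)) (u v : Fin n → ℝ) :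
    finslerG n F x y u v = 1 / 2 * fderiv ℝ (fderiv ℝ (energy F)) (x, y) (0, u) (0, v) := by
  rw [← fderiv_fderiv_partial_right h, finslerG, iteratedFDeriv_two_apply]
  rfl

theorem finslerG_apply_self (h : ContDiffAt ℝ 2 (energy F) (x, y))
    (hhom : ∀ t : ℝ, 0 < t → ∀ z : Fin n → ℝ, F x (t • z) = t * F x z) (u : Fin n → ℝ) :
    finslerG n F x y u y = 1 / 2 * fderiv ℝ (energy F) (x, y) (0, u) := by
  have hcont : Filter.Tendsto (fun z => (x, z)) (nhds y) (nhds (x, y)) :=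
    (Continuous.prodMk_right x).tendsto y
  have hf : ContDiffAt ℝ 2 (fun z => energy F (x, z)) y :=
    h.comp y (contDiffAt_const.prodMk contDiffAt_id)
  rw [finslerG_eq h, ← fderiv_fderiv_partial_right h, fderiv_fderiv_apply_self hf,
    (hasFDerivAt_partial_right (h.differentiableAt (by simp))).fderiv]
  · simp
  · filter_upwards [eventually_differentiableAt hf] with z hz
    refine fderiv_apply_self_of_homogeneous hz fun t ht => ?_
    simp only [energy, hhom t ht]
    ring

theorem finslerG_eq_sum_single (h : ContDiffAt ℝ 2 (energy F) (x, y)) (u v : Fin n → ℝ) :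
    finslerG n F x y u v = ∑ i, v i * finslerG n F x y u (Pi.single i 1) := by
  simp only [finslerG_eq h]
  exact apply_eq_sum_single ((1 / 2 : ℝ) • (fderiv ℝ (fderiv ℝ (energy F)) (x, y) (0, u)).comp
    (ContinuousLinearMap.inr ℝ _ _)) v

theorem finslerGMat_mulVec (h : ContDiffAt ℝ 2 (energy F) (x, y)) (v : Fin n → ℝ) (i : Fin n) :
    (finslerGMat n F x y).mulVec v i = finslerG n F x y (Pi.single i 1) v := by
  rw [finslerG_eq_sum_single h]
  simp only [Matrix.mulVec, dotProduct, finslerGMat, mul_comm]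

theorem isUnit_det_finslerGMat (h : ContDiffAt ℝ 2 (energy F) (x, y))
    (hsymm : ∀ u v, finslerG n F x y u v = finslerG n F x y v u)
    (hpos : ∀ u : Fin n → ℝ, u ≠ 0 → 0 < finslerG n F x y u u) :
    IsUnit (finslerGMat n F x y).det := by
  rw [isUnit_iff_ne_zero]
  intro hdet
  obtain ⟨v, hv, hv0⟩ := Matrix.exists_mulVec_eq_zero_iff.mpr hdet
  refine (hpos v hv).ne' ?_
  rw [finslerG_eq_sum_single h]
  refine Finset.sum_eq_zero fun i _ => ?_
  rw [hsymm, ← finslerGMat_mulVec h, hv0, Pi.zero_apply, mul_zero]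

/-- The geodesic equation in Euler–Lagrange form. -/
theorem euler_lagrange (h : ContDiffAt ℝ 2 (energy F) (x, y))
    (hsymm : ∀ u v, finslerG n F x y u v = finslerG n F x y v u)
    (hpos : ∀ u : Fin n → ℝ, u ≠ 0 → 0 < finslerG n F x y u u) {a : Fin n → ℝ}
    (ha : ∀ i, a i + 2 * finslerSpray n F x y i = 0) (w : Fin n → ℝ) :
    fderiv ℝ (fderiv ℝ (energy F)) (x, y) (y, a) (0, w)
      = fderiv ℝ (energy F) (x, y) (w, 0) := by
  let D := fderiv ℝ (fderiv ℝ (energy F)) (x, y)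
  let b : Fin n → ℝ := fun l =>
    D (y, 0) (0, Pi.single l 1) - fderiv ℝ (energy F) (x, y) (Pi.single l 1, 0)
  have hspray : ∀ i, finslerSpray n F x y i
      = 1 / 4 * ((finslerGMat n F x y)⁻¹.mulVec b) i := by
    intro i
    unfold finslerSpray
    congr 1
    refine Finset.sum_congr rfl fun l _ => ?_
    congr 2
    · have hk : ∀ k, fderiv ℝ (fun x' => fderiv ℝ (fun z => (F x' z) ^ 2) y (Pi.single l 1)) x
          (Pi.single k 1) = D (Pi.single k 1, 0) (0, Pi.single l 1) := fun k =>
        fderiv_partial_left_fderiv_partial_right h _ _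
      simp only [hk, mul_comm _ (y _)]
      exact (apply_eq_sum_single ((D.flip (0, Pi.single l 1)).comp
        (ContinuousLinearMap.inl ℝ _ _)) y).symm
    · exact congrArg (fun L => L (Pi.single l 1))
        (hasFDerivAt_partial_left (h.differentiableAt (by simp))).fderiv
  have hab : a = (-(1 / 2) : ℝ) • (finslerGMat n F x y)⁻¹.mulVec b := by
    ext i
    have := ha i
    rw [hspray] at this
    simp only [Pi.smul_apply, smul_eq_mul]
    linarith
  have hl : ∀ l, D (y, a) (0, Pi.single l 1)
      = fderiv ℝ (energy F) (x, y) (Pi.single l 1, 0) := by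
    intro l
    have h1 : (finslerGMat n F x y).mulVec a l = -(1 / 2) * b l := by
      rw [hab, Matrix.mulVec_smul, Matrix.mulVec_mulVec,
        Matrix.mul_nonsing_inv _ (isUnit_det_finslerGMat h hsymm hpos), Matrix.one_mulVec]
      rfl
    rw [finslerGMat_mulVec h, hsymm, finslerG_eq h] at h1
    have h2 : D (y, a) = D (y, 0) + D (0, a) := by rw [← map_add]; simp
    rw [h2, add_apply]
    change 1 / 2 * D (0, a) (0, Pi.single l 1) = -(1 / 2) * (D (y, 0) (0, Pi.single l 1)
      - fderiv ℝ (energy F) (x, y) (Pi.single l 1, 0)) at h1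
    linarith
  have e1 := apply_eq_sum_single ((D (y, a)).comp (ContinuousLinearMap.inr ℝ _ _)) w
  have e2 := apply_eq_sum_single ((fderiv ℝ (energy F) (x, y)).comp
    (ContinuousLinearMap.inl ℝ _ _)) w
  simp only [ContinuousLinearMap.comp_apply, ContinuousLinearMap.inl_apply,
    ContinuousLinearMap.inr_apply, hl] at e1 e2
  exact e1.trans e2.symm

end Finsler

end FinslerHomothetic

open FinslerHomothetic

/-- along a unit-speed geodesic `γ` of a Finsler metric `F`, a homothetic
vector field `V` with dilation `c` satisfies
`g_{(γ(t),γ̇(t))}(V(γ(t)), γ̇(t)) = c₀ − 2ct` where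
`c₀ = g_{(γ(0),γ̇(0))}(V(γ(0)), γ̇(0))`. -/
theorem homothetic_field_along_geodesic
    (n : ℕ) (M : Set (Fin n → ℝ)) (hM : IsOpen M)
    (F : (Fin n → ℝ) → (Fin n → ℝ) → ℝ)
    (hFsmooth : ContDiffOn ℝ (⊤ : ℕ∞)
      (fun p : (Fin n → ℝ) × (Fin n → ℝ) => F p.1 p.2) (M ×ˢ {(0 : Fin n → ℝ)}ᶜ))
    (hFpos : ∀ x ∈ M, ∀ y : Fin n → ℝ, y ≠ 0 → 0 < F x y)
    (hFhomog : ∀ x ∈ M, ∀ t : ℝ, 0 < t → ∀ y : Fin n → ℝ, F x (t • y) = t * F x y)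
    (hGsymm : ∀ x ∈ M, ∀ y : Fin n → ℝ, y ≠ 0 →
      ∀ u v : Fin n → ℝ, finslerG n F x y u v = finslerG n F x y v u)
    (hGposdef : ∀ x ∈ M, ∀ y : Fin n → ℝ, y ≠ 0 →
      ∀ u : Fin n → ℝ, u ≠ 0 → 0 < finslerG n F x y u u)
    (V : (Fin n → ℝ) → (Fin n → ℝ)) (hVsmooth : ContDiffOn ℝ (⊤ : ℕ∞) V M)
    (c : ℝ)
    (hhom : ∀ x ∈ M, ∀ y : Fin n → ℝ, y ≠ 0 →
      (∑ i, V x i * fderiv ℝ (fun x' => F x' y) x (Pi.single i 1)) +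
      (∑ i, (∑ j, y j * fderiv ℝ (fun x' => V x' i) x (Pi.single j 1)) *
        fderiv ℝ (fun z => F x z) y (Pi.single i 1)) = -2 * c * F x y)
    (I : Set ℝ) (hIopen : IsOpen I) (hIconn : I.OrdConnected) (h0I : (0 : ℝ) ∈ I)
    (γ : ℝ → (Fin n → ℝ)) (hγsmooth : ContDiffOn ℝ (⊤ : ℕ∞) γ I)
    (hγM : ∀ t ∈ I, γ t ∈ M)
    (hunit : ∀ t ∈ I, F (γ t) (deriv γ t) = 1)
    (hgeo : ∀ t ∈ I, ∀ i : Fin n,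
      deriv (deriv γ) t i + 2 * finslerSpray n F (γ t) (deriv γ t) i = 0) :
    ∀ t ∈ I, finslerG n F (γ t) (deriv γ t) (V (γ t)) (deriv γ t)
      = finslerG n F (γ 0) (deriv γ 0) (V (γ 0)) (deriv γ 0) - 2 * c * t := by
  intro t ht
  have hU : IsOpen (M ×ˢ {(0 : Fin n → ℝ)}ᶜ) := hM.prod isOpen_compl_singleton
  have hFat : ∀ x ∈ M, ∀ y : Fin n → ℝ, y ≠ 0 →
      ContDiffAt ℝ 2 (fun p : (Fin n → ℝ) × (Fin n → ℝ) => F p.1 p.2) (x, y) := fun x hx y hy =>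
    (hFsmooth.contDiffAt (hU.mem_nhds (Set.mk_mem_prod hx hy))).of_le
      (WithTop.coe_le_coe.mpr le_top)
  have hE : ∀ x ∈ M, ∀ y : Fin n → ℝ, y ≠ 0 → ContDiffAt ℝ 2 (energy F) (x, y) :=
    fun x hx y hy => (hFat x hx y hy).pow 2
  have hvel : ∀ s ∈ I, deriv γ s ≠ 0 := by
    intro s hs h0
    have h1 := hunit s hs
    have h2 := hFhomog _ (hγM s hs) 2 two_pos 0
    rw [h0] at h1
    rw [smul_zero] at h2
    linarith
  have hEc : ∀ s ∈ I, ContDiffAt ℝ 2 (energy F) (γ s, deriv γ s) :=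
    fun s hs => hE _ (hγM s hs) _ (hvel s hs)
  have hG : ∀ s ∈ I, finslerG n F (γ s) (deriv γ s) (V (γ s)) (deriv γ s)
      = 1 / 2 * fderiv ℝ (energy F) (γ s, deriv γ s) (0, V (γ s)) := fun s hs =>
    finslerG_apply_self (hEc s hs) (hFhomog _ (hγM s hs)) _
  have hderiv : ∀ s ∈ I, HasDerivAt
      (fun r => 1 / 2 * fderiv ℝ (energy F) (γ r, deriv γ r) (0, V (γ r)) + 2 * c * r) 0 s := by
    intro s hs
    have hγat : ContDiffAt ℝ 2 γ s :=
      (hγsmooth.contDiffAt (hIopen.mem_nhds hs)).of_le (WithTop.coe_le_coe.mpr le_top)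
    have hγ1 : HasDerivAt γ (deriv γ s) s := (hγat.differentiableAt (by simp)).hasDerivAt
    have hγ2 : HasDerivAt (deriv γ) (deriv (deriv γ) s) s := by
      have : ContDiffAt ℝ 1 (deriv γ) s := hγat.derivWithin (by norm_num)
      exact (this.differentiableAt (by simp)).hasDerivAt
    have hV : DifferentiableAt ℝ V (γ s) :=
      (hVsmooth.contDiffAt (hM.mem_nhds (hγM s hs))).differentiableAt (by simp)
    have hVγ : HasDerivAt (fun r => ((0 : Fin n → ℝ), V (γ r)))
        (0, fderiv ℝ V (γ s) (deriv γ s)) s :=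
      (hasDerivAt_const s 0).prodMk (hV.hasFDerivAt.comp_hasDerivAt s hγ1)
    have hdE : HasDerivAt (fun r => fderiv ℝ (energy F) (γ r, deriv γ r))
        (fderiv ℝ (fderiv ℝ (energy F)) (γ s, deriv γ s) (deriv γ s, deriv (deriv γ) s)) s :=
      HasFDerivAt.comp_hasDerivAt (f := fun r => (γ r, deriv γ r)) s
        (differentiableAt_fderiv (hEc s hs)).hasFDerivAt (hγ1.prodMk hγ2)
    have key := ((hdE.clm_apply hVγ).const_mul (1 / 2)).add ((hasDerivAt_id s).const_mul (2 * c))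
    refine key.congr_deriv ?_
    rw [euler_lagrange (hEc s hs) (hGsymm _ (hγM s hs) _ (hvel s hs))
      (hGposdef _ (hγM s hs) _ (hvel s hs)) (hgeo s hs)]
    have hFd := (hFat _ (hγM s hs) _ (hvel s hs)).differentiableAt (by simp)
    have hEF : fderiv ℝ (energy F) (γ s, deriv γ s)
        = (2 : ℝ) • fderiv ℝ (fun p : (Fin n → ℝ) × (Fin n → ℝ) => F p.1 p.2)
            (γ s, deriv γ s) := by
      refine (hFd.hasFDerivAt.pow 2).fderiv.trans ?_
      simp [hunit s hs]
    have hh := hhom _ (hγM s hs) _ (hvel s hs)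
    have hVi : ∀ i, ∑ j, deriv γ s j * fderiv ℝ (fun x' => V x' i) (γ s) (Pi.single j 1)
        = fderiv ℝ V (γ s) (deriv γ s) i := by
      intro i
      rw [← apply_eq_sum_single, fderiv_apply hV]
      rfl
    simp only [hVi] at hh
    rw [← apply_eq_sum_single, ← apply_eq_sum_single,
      (hasFDerivAt_partial_left hFd).fderiv, (hasFDerivAt_partial_right hFd).fderiv,
      hunit s hs] at hh
    simp only [ContinuousLinearMap.comp_apply, ContinuousLinearMap.inl_apply,
      ContinuousLinearMap.inr_apply] at hh
    rw [hEF]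
    simp only [smul_apply, smul_eq_mul]
    linarith
  have hconst := hIopen.is_const_of_deriv_eq_zero hIconn.isPreconnected
    (fun s hs => (hderiv s hs).differentiableAt.differentiableWithinAt)
    (fun s hs => (hderiv s hs).deriv) ht h0I
  rw [hG t ht, hG 0 h0I]
  linarith
end
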